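/- Let G be the simple graph with vertex set {A_1,…,A_6, B_1, B_2, B_3} and edges: A_i ~ A_{i+1} for i = 1,…,4, A_5 ~ A_1, and A_i ~ B_j for all i ∈ {1,…,6}, j ∈ {1,2,3}. Then there exists a no-disturbance model on G with outcomes in {−1,+1} such that simultaneously I_B = 13/3 > 4 and I(5) = 4 > 3, where I_B = ⟨A_1⟩ + ⟨A_4⟩ + ⟨B_1⟩ + ⟨B_2⟩ − ⟨A_1B_1⟩ − ⟨A_1B_2⟩ − ⟨A_1B_3⟩ − ⟨A_4B_1⟩ − ⟨A_4B_2⟩ + ⟨A_4B_3⟩ − ⟨A_6B_1⟩ + ⟨A_6B_2⟩ and I(5) = Σ_{i=1}^{4} ⟨A_iA_{i+1}⟩ − ⟨A_5A_1⟩. In particular, a single I_3322 Bell inequality does not exhibit a monogamy relation with the local 5-cycle non-contextuality inequality. -/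

import Mathlib

/-- The two-element set of outcomes `{−1, +1}` (as a subtype of `ℤ`). -/
abbrev Sgn : Type := ({-1, 1} : Finset ℤ)

instance : Nonempty Sgn := ⟨⟨1, by decide⟩⟩

/-- A finite simple graph is *chordal* if every cycle of length at least 4 has a
chord, i.e. an edge of the graph joining two vertices of the cycle that are not
consecutive on the cycle. -/
def SimpleGraph.IsChordal {W : Type*} (G : SimpleGraph W) : Prop :=
  ∀ (v : W) (c : G.Walk v v), c.IsCycle → 4 ≤ c.length →
    ∃ u w : W, u ∈ c.support ∧ w ∈ c.support ∧ G.Adj u w ∧ ¬ c.toSubgraph.Adj u w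

/-- A *no-disturbance model* with outcomes in `{−1,+1}` on a finite simple graph `G`
assigns to each clique `C` of `G` a probability distribution `p C` on the functions
`C → {−1,+1}`, such that whenever `C ⊆ D` are cliques, `p C` is the marginal of
`p D`. -/
structure NDModel {V : Type*} [Fintype V] [DecidableEq V] (G : SimpleGraph V) where
  p : (C : Finset V) → (C → Sgn) → ℝ
  nonneg : ∀ C : Finset V, G.IsClique (C : Set V) → ∀ f : C → Sgn, 0 ≤ p C f
  normalized : ∀ C : Finset V, G.IsClique (C : Set V) → ∑ f : C → Sgn, p C f = 1
  nodisturb : ∀ C D : Finset V, ∀ hCD : C ⊆ D, G.IsClique (D : Set V) →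
    ∀ g : C → Sgn,
      p C g = ∑ f : D → Sgn, if (∀ x : C, f ⟨x.1, hCD x.2⟩ = g x) then p D f else 0

/-- The correlator `⟨uv⟩ = Σ_f f(u)f(v)·p_{{u,v}}(f)` of two (adjacent) vertices. -/
def NDModel.corr {V : Type*} [Fintype V] [DecidableEq V] {G : SimpleGraph V}
    (M : NDModel G) (u v : V) : ℝ :=
  ∑ f : ({u, v} : Finset V) → Sgn,
    (((f ⟨u, by simp⟩ : ℤ) * (f ⟨v, by simp⟩ : ℤ) : ℤ) : ℝ) * M.p {u, v} f

/-- The single-vertex mean `⟨u⟩ = Σ_f f(u)·p_{{u}}(f)`. -/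
def NDModel.mean {V : Type*} [Fintype V] [DecidableEq V] {G : SimpleGraph V}
    (M : NDModel G) (u : V) : ℝ :=
  ∑ f : ({u} : Finset V) → Sgn, ((f ⟨u, by simp⟩ : ℤ) : ℝ) * M.p {u} f

/-- The nine observables: Alice's `A₁,…,A₆` and Bob's `B₁,B₂,B₃` (indexed from `0`). -/
inductive Obs : Type
  | A (i : Fin 6)
  | B (j : Fin 3)
  deriving DecidableEq, Fintype

open Obs in
/-- Base relation for the commutation graph: the 5-cycle `A₁A₂A₃A₄A₅` together with
all edges `A_i ∼ B_j`. -/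
def baseRel : Obs → Obs → Prop
  | A i, A j => (i.val ≤ 3 ∧ j.val = i.val + 1) ∨ (i.val = 4 ∧ j.val = 0)
  | A _, B _ => True
  | _, _ => False

/-- The commutation graph of the combined `I_3322`–5-cycle experiment. -/
def G9 : SimpleGraph Obs := SimpleGraph.fromRel baseRel

open Obs in
/-- The `I_3322` Bell expression between Alice and Bob. -/
noncomputable def IB (M : NDModel G9) : ℝ :=
  M.mean (A 0) + M.mean (A 3) + M.mean (B 0) + M.mean (B 1)
    - M.corr (A 0) (B 0) - M.corr (A 0) (B 1) - M.corr (A 0) (B 2)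
    - M.corr (A 3) (B 0) - M.corr (A 3) (B 1) + M.corr (A 3) (B 2)
    - M.corr (A 5) (B 0) + M.corr (A 5) (B 1)

open Obs in
/-- The 5-cycle (KCBS-type) non-contextuality expression
`I(5) = Σ_{i=1}^{4} ⟨A_iA_{i+1}⟩ − ⟨A₅A₁⟩` on Alice's observables. -/
noncomputable def I5 (M : NDModel G9) : ℝ :=
  M.corr (A 0) (A 1) + M.corr (A 1) (A 2) + M.corr (A 2) (A 3)
    + M.corr (A 3) (A 4) - M.corr (A 4) (A 0)

namespace NDModel

variable {V ι : Type*} [DecidableEq V] [Fintype ι]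

/-- The marginal on `C` of the signed measure with weight `w k` on the assignment `F k`. -/
def signedMarginal (w : ι → ℝ) (F : ι → V → Sgn) (C : Finset V) (f : C → Sgn) : ℝ :=
  ∑ k, if ∀ x : C, F k x = f x then w k else 0

theorem sum_mul_signedMarginal (w : ι → ℝ) (F : ι → V → Sgn) (C : Finset V)
    (φ : (C → Sgn) → ℝ) :
    ∑ f, φ f * signedMarginal w F C f = ∑ k, φ (fun x => F k x) * w k := by
  simp only [signedMarginal, Finset.mul_sum]
  rw [Finset.sum_comm]
  refine Finset.sum_congr rfl fun k _ => ?_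
  rw [Finset.sum_eq_single (fun x : C => F k x)]
  · simp
  · intro f _ hf
    rw [if_neg fun h => hf (funext fun x => (h x).symm), mul_zero]
  · simp

theorem signedMarginal_eq_sum (w : ι → ℝ) (F : ι → V → Sgn) {C D : Finset V} (hCD : C ⊆ D)
    (g : C → Sgn) :
    signedMarginal w F C g =
      ∑ f : D → Sgn,
        if (∀ x : C, f ⟨x.1, hCD x.2⟩ = g x) then signedMarginal w F D f else 0 := by
  have h := sum_mul_signedMarginal w F D
    fun f => if (∀ x : C, f ⟨x.1, hCD x.2⟩ = g x) then 1 else 0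
  simp only [ite_mul, one_mul, zero_mul] at h
  exact h.symm

theorem signedMarginal_nonneg_of_subset {w : ι → ℝ} {F : ι → V → Sgn} {C D : Finset V}
    (hCD : C ⊆ D) (hD : ∀ f, 0 ≤ signedMarginal w F D f) (g : C → Sgn) :
    0 ≤ signedMarginal w F C g := by
  rw [signedMarginal_eq_sum w F hCD]
  refine Finset.sum_nonneg fun f _ => ?_
  split_ifs
  exacts [hD f, le_rfl]

variable [Fintype V]

/-- A signed measure of total mass one on global assignments whose marginals on cliques are
nonnegative induces a no-disturbance model. -/
def ofSigned (G : SimpleGraph V) (w : ι → ℝ) (F : ι → V → Sgn) (hw : ∑ k, w k = 1)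
    (hpos : ∀ C : Finset V, G.IsClique (C : Set V) → ∀ f, 0 ≤ signedMarginal w F C f) :
    NDModel G where
  p := signedMarginal w F
  nonneg := hpos
  normalized C _ := by
    simpa [hw] using sum_mul_signedMarginal w F C fun _ => 1
  nodisturb _ _ hCD _ g := signedMarginal_eq_sum w F hCD g

variable {G : SimpleGraph V} {w : ι → ℝ} {F : ι → V → Sgn} {hw : ∑ k, w k = 1}
  {hpos : ∀ C : Finset V, G.IsClique (C : Set V) → ∀ f, 0 ≤ signedMarginal w F C f}

theorem corr_ofSigned (u v : V) :
    (ofSigned G w F hw hpos).corr u v =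
      ∑ k, (((F k u : ℤ) * (F k v : ℤ) : ℤ) : ℝ) * w k :=
  sum_mul_signedMarginal w F _ _

theorem mean_ofSigned (u : V) :
    (ofSigned G w F hw hpos).mean u = ∑ k, ((F k u : ℤ) : ℝ) * w k :=
  sum_mul_signedMarginal w F _ _

end NDModel

open Obs

/-- The successor of `i` on the 5-cycle; the isolated index `5` is its own successor. -/
def cycleNext : Fin 6 → Fin 6 := ![1, 2, 3, 4, 0, 5]

theorem exists_subset_of_isClique {C : Finset Obs} (hC : G9.IsClique (C : Set Obs)) :
    ∃ i j, C ⊆ {A i, A (cycleNext i), B j} := by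
  have hA : ∃ i, ∀ i', A i' ∈ C → i' = i ∨ i' = cycleNext i := by
    have key : ∀ S : Finset (Fin 6),
        (∀ a ∈ S, ∀ b ∈ S, a ≠ b → b = cycleNext a ∨ a = cycleNext b) →
          ∃ i, ∀ i' ∈ S, i' = i ∨ i' = cycleNext i := by
      decide
    obtain ⟨i, hi⟩ := key {i | A i ∈ C} (by
      intro a ha b hb hab
      have h : G9.Adj (A a) (A b) :=
        hC (by simpa using ha) (by simpa using hb) (by simpa using hab)
      simp only [G9, SimpleGraph.fromRel_adj, baseRel] at h
      clear ha hb
      revert a b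
      decide)
    exact ⟨i, fun i' h => hi i' (by simpa using h)⟩
  have hB : ∃ j, ∀ j', B j' ∈ C → j' = j := by
    by_cases h : ∃ j, B j ∈ C
    · obtain ⟨j, hj⟩ := h
      refine ⟨j, fun j' hj' => ?_⟩
      by_contra hne
      have h : G9.Adj (B j') (B j) := hC hj' hj (by simpa using hne)
      simp [G9, baseRel] at h
    · exact ⟨0, fun j' hj' => (h ⟨j', hj'⟩).elim⟩
  obtain ⟨i, hi⟩ := hA
  obtain ⟨j, hj⟩ := hB
  refine ⟨i, j, ?_⟩
  rintro (i' | j') h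
  · simpa using hi i' h
  · simpa using hj j' h

/-- The observables with outcome `-1` in each of the ten global assignments. -/
def negativeObs : Fin 10 → Finset Obs :=
  ![{A 5, B 1}, {B 0}, {A 5, B 0, B 1}, {A 0, A 1, A 2, A 3, A 4}, ∅, {A 5, B 0}, {A 5},
    {A 0, A 4}, {A 4}, {A 0}]

/-- The global assignment with outcome `-1` exactly on `negativeObs k`. -/
def assignment (k : Fin 10) (v : Obs) : Sgn :=
  if v ∈ negativeObs k then ⟨-1, by decide⟩ else ⟨1, by decide⟩

/-- Twelve times the signed weights of the global assignments. -/
def weight : Fin 10 → ℤ := ![3, 4, 3, 3, -4, -1, 1, -3, 3, 3]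

theorem sum_weight_nonneg : ∀ (i : Fin 6) (j : Fin 3) (a b c : Sgn),
    0 ≤ ∑ k, if assignment k (A i) = a ∧ assignment k (A (cycleNext i)) = b ∧
      assignment k (B j) = c then weight k else 0 := by
  decide +kernel

theorem signedMarginal_assignment_nonneg {C : Finset Obs} (hC : G9.IsClique (C : Set Obs))
    (f : C → Sgn) :
    0 ≤ NDModel.signedMarginal (fun k => (weight k : ℝ) / 12) assignment C f := by
  obtain ⟨i, j, hij⟩ := exists_subset_of_isClique hC
  refine NDModel.signedMarginal_nonneg_of_subset hij (fun g => ?_) f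
  have h := sum_weight_nonneg i j (g ⟨A i, by simp⟩) (g ⟨A (cycleNext i), by simp⟩)
    (g ⟨B j, by simp⟩)
  have h' : NDModel.signedMarginal (fun k => (weight k : ℝ) / 12) assignment _ g =
      ((∑ k, if assignment k (A i) = g ⟨A i, by simp⟩ ∧
        assignment k (A (cycleNext i)) = g ⟨A (cycleNext i), by simp⟩ ∧
        assignment k (B j) = g ⟨B j, by simp⟩ then weight k else 0 : ℤ) : ℝ) / 12 := by
    rw [NDModel.signedMarginal, Int.cast_sum, Finset.sum_div]
    refine Finset.sum_congr rfl fun k _ => ?_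
    rw [Int.cast_ite, ite_div, Int.cast_zero, zero_div]
    refine if_congr ⟨fun hx => ⟨hx ⟨A i, by simp⟩, hx ⟨A (cycleNext i), by simp⟩,
      hx ⟨B j, by simp⟩⟩, ?_⟩ rfl rfl
    rintro ⟨h₁, h₂, h₃⟩ ⟨x, hx⟩
    have hx' := hx
    simp only [Finset.mem_insert, Finset.mem_singleton] at hx'
    rcases hx' with rfl | rfl | rfl
    exacts [h₁, h₂, h₃]
  rw [h']
  positivity

theorem sum_weight : ∑ k, (weight k : ℝ) / 12 = 1 := by
  have h : ∑ k, weight k = 12 := by decide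
  rw [← Finset.sum_div, ← Int.cast_sum, h]
  norm_num

/-- The no-disturbance model induced by the signed weights. -/
noncomputable def signedModel : NDModel G9 :=
  NDModel.ofSigned G9 _ assignment sum_weight fun _ => signedMarginal_assignment_nonneg

theorem corr_signedModel (u v : Obs) : signedModel.corr u v =
    ((∑ k, (assignment k u : ℤ) * (assignment k v : ℤ) * weight k : ℤ) : ℝ) / 12 := by
  rw [signedModel, NDModel.corr_ofSigned]
  push_cast
  rw [Finset.sum_div]
  exact Finset.sum_congr rfl fun k _ => by ring

theorem mean_signedModel (u : Obs) : signedModel.mean u =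
    ((∑ k, (assignment k u : ℤ) * weight k : ℤ) : ℝ) / 12 := by
  rw [signedModel, NDModel.mean_ofSigned]
  push_cast
  rw [Finset.sum_div]
  exact Finset.sum_congr rfl fun k _ => by ring

/-- There is a no-disturbance model on `G9` with simultaneously
`I_B = 13/3 > 4` (violating the classical bound `4` of `I_3322`) and `I(5) = 4 > 3`
(violating the non-contextual bound `3` of the 5-cycle inequality): a single
`I_3322` Bell inequality does not exhibit a monogamy relation with the local
5-cycle non-contextuality inequality. -/
theorem no_monogamy_I3322_KCBS :
    ∃ M : NDModel G9, IB M = 13 / 3 ∧ I5 M = 4 ∧ IB M > 4 ∧ I5 M > 3 := by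
  have hIB : IB signedModel = 13 / 3 := by
    simp only [IB, mean_signedModel, corr_signedModel]
    rw [(show ∑ k, (assignment k (A 0) : ℤ) * weight k = 6 by decide),
      (show ∑ k, (assignment k (A 3) : ℤ) * weight k = 6 by decide),
      (show ∑ k, (assignment k (B 0) : ℤ) * weight k = 0 by decide),
      (show ∑ k, (assignment k (B 1) : ℤ) * weight k = 0 by decide),
      (show ∑ k, (assignment k (A 0) : ℤ) * (assignment k (B 0) : ℤ) * weight k = -6 by decide),
      (show ∑ k, (assignment k (A 0) : ℤ) * (assignment k (B 1) : ℤ) * weight k = -6 by decide),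
      (show ∑ k, (assignment k (A 0) : ℤ) * (assignment k (B 2) : ℤ) * weight k = 6 by decide),
      (show ∑ k, (assignment k (A 3) : ℤ) * (assignment k (B 0) : ℤ) * weight k = -6 by decide),
      (show ∑ k, (assignment k (A 3) : ℤ) * (assignment k (B 1) : ℤ) * weight k = -6 by decide),
      (show ∑ k, (assignment k (A 3) : ℤ) * (assignment k (B 2) : ℤ) * weight k = 6 by decide),
      (show ∑ k, (assignment k (A 5) : ℤ) * (assignment k (B 0) : ℤ) * weight k = -4 by decide),
      (show ∑ k, (assignment k (A 5) : ℤ) * (assignment k (B 1) : ℤ) * weight k = 12 by decide)]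
    norm_num
  have hI5 : I5 signedModel = 4 := by
    simp only [I5, corr_signedModel]
    rw [(show ∑ k, (assignment k (A 0) : ℤ) * (assignment k (A 1) : ℤ) * weight k = 12 by decide),
      (show ∑ k, (assignment k (A 1) : ℤ) * (assignment k (A 2) : ℤ) * weight k = 12 by decide),
      (show ∑ k, (assignment k (A 2) : ℤ) * (assignment k (A 3) : ℤ) * weight k = 12 by decide),
      (show ∑ k, (assignment k (A 3) : ℤ) * (assignment k (A 4) : ℤ) * weight k = 12 by decide),
      (show ∑ k, (assignment k (A 4) : ℤ) * (assignment k (A 0) : ℤ) * weight k = 0 by decide)]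
    norm_num
  refine ⟨signedModel, hIB, hI5, ?_, ?_⟩
  · rw [hIB]; norm_num
  · rw [hI5]; norm_num
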